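/- arXiv:2512.10838 — 6 statements merged into one kernel-verified Lean document; each statement's English description precedes it below -/
import Mathlib

section
/- Let O be a principal ideal domain with fraction field K, p ∈ O a prime element, and U a K-subspace of K^ℓ. Let π : K^ℓ → (K/O)^ℓ be the canonical projection. Then the p-torsion submodule π(U)[p] of π(U) is naturally a vector space over the residue field O/⟨p⟩, and its dimension over O/⟨p⟩ equals dim_K U. -/
noncomputable section

/-- The image of `O` in `K` as an `O`-submodule. -/
def OinK (O K : Type*) [CommRing O] [CommRing K] [Algebra O K] : Submodule O K :=
  LinearMap.range (Algebra.linearMap O K)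

/-- The coordinatewise canonical projection `π : K^ℓ → (K/O)^ℓ`. -/
def piMap (O K : Type*) [CommRing O] [CommRing K] [Algebra O K] (ℓ : ℕ) :
    (Fin ℓ → K) →ₗ[O] (Fin ℓ → K ⧸ OinK O K) :=
  LinearMap.pi fun i => (OinK O K).mkQ.comp (LinearMap.proj i)

/-- The image `π(U)` of a `K`-subspace `U ⊆ K^ℓ` under `π`, as an `O`-submodule of `(K/O)^ℓ`. -/
def piU (O : Type*) {K : Type*} [CommRing O] [CommRing K] [Algebra O K] {ℓ : ℕ}
    (U : Submodule K (Fin ℓ → K)) : Submodule O (Fin ℓ → K ⧸ OinK O K) :=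
  (U.restrictScalars O).map (piMap O K ℓ)

theorem finrank_aux {O L T : Type*} [CommRing O] (p : O) (hp : ¬ IsUnit p)
    [AddCommGroup L] [Module O L] [AddCommGroup T] [Module O T]
    [Module (O ⧸ Ideal.span {p}) T]
    (hs : ∀ (a : O) (t : T), Ideal.Quotient.mk (Ideal.span {p}) a • t = a • t)
    {n : ℕ} (b : Module.Basis (Fin n) O L) (g : L →ₗ[O] T)
    (gker : ∀ x, g x = 0 → ∃ y : L, x = p • y) (gsurj : Function.Surjective g) :
    Module.finrank (O ⧸ Ideal.span {p}) T = n := by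
  have : Nontrivial (O ⧸ Ideal.span {p}) := by
    rw [Ideal.Quotient.nontrivial_iff, Ne, Ideal.span_singleton_eq_top]
    exact hp
  have gli : LinearIndependent (O ⧸ Ideal.span {p}) (fun i => g (b i)) := by
    refine Fintype.linearIndependent_iff.2 ?_
    intro c hc i
    choose d hd using fun i => Ideal.Quotient.mk_surjective (c i)
    have h1 : g (∑ i, d i • b i) = 0 := by
      rw [map_sum, ← hc]
      refine Finset.sum_congr rfl fun i _ => ?_
      rw [map_smul, ← hd i]
      exact (hs _ _).symm
    obtain ⟨y, hy⟩ := gker _ h1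
    have h2 := congrArg (fun z => b.repr z i) hy
    simp only [b.repr_sum_self, map_smul, Finsupp.smul_apply, smul_eq_mul] at h2
    rw [← hd i, Ideal.Quotient.eq_zero_iff_mem, Ideal.mem_span_singleton, h2]
    exact dvd_mul_right _ _
  have gsp : ⊤ ≤ Submodule.span (O ⧸ Ideal.span {p}) (Set.range fun i => g (b i)) := by
    rintro t -
    obtain ⟨x, rfl⟩ := gsurj t
    rw [← b.sum_repr x, map_sum]
    refine Submodule.sum_mem _ fun i _ => ?_
    rw [map_smul, ← hs]
    exact Submodule.smul_mem _ _ (Submodule.subset_span ⟨i, rfl⟩)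
  rw [Module.finrank_eq_card_basis (Module.Basis.mk gli gsp), Fintype.card_fin]

theorem piMap_eq_zero_iff {O K : Type*} [CommRing O] [CommRing K] [Algebra O K] {ℓ : ℕ}
    (u : Fin ℓ → K) :
    piMap O K ℓ u = 0 ↔ ∃ x : Fin ℓ → O, (Algebra.linearMap O K).compLeft (Fin ℓ) x = u := by
  constructor
  · intro h
    have h1 : ∀ i, ∃ y : O, algebraMap O K y = u i := by
      intro i
      have h2 := congrFun h i
      have h3 : (OinK O K).mkQ (u i) = 0 := h2
      rw [Submodule.mkQ_apply, Submodule.Quotient.mk_eq_zero] at h3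
      exact h3
    choose x hx using h1
    exact ⟨x, funext hx⟩
  · rintro ⟨x, rfl⟩
    funext i
    change (OinK O K).mkQ (algebraMap O K (x i)) = 0
    rw [Submodule.mkQ_apply, Submodule.Quotient.mk_eq_zero]
    exact ⟨x i, rfl⟩

/-- For a PID `O` with fraction field `K`, a prime element `p ∈ O`, and a `K`-subspace
`U ⊆ K^ℓ`, the `p`-torsion submodule `π(U)[p]` is a vector space over the residue field
`O/⟨p⟩` (via the canonical module structure) and its dimension equals `dim_K U`. -/
theorem stmt1 {O K : Type*} [CommRing O] [IsDomain O] [IsPrincipalIdealRing O]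
    [Field K] [Algebra O K] [IsFractionRing O K]
    (ℓ : ℕ) (p : O) (hp : Prime p) (U : Submodule K (Fin ℓ → K)) :
    Module.finrank (O ⧸ Ideal.span {p}) (Submodule.torsionBy O (piU O U) p) =
      Module.finrank K U := by
  classical
  set j : (Fin ℓ → O) →ₗ[O] (Fin ℓ → K) := (Algebra.linearMap O K).compLeft (Fin ℓ) with hj
  have hinj : Function.Injective (algebraMap O K) := IsFractionRing.injective O K
  have jinj : Function.Injective j := by
    intro x y h
    funext i
    exact hinj (congrFun h i)
  let L : Submodule O (Fin ℓ → O) := (U.restrictScalars O).comap j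
  obtain ⟨n, ⟨b⟩⟩ := Submodule.nonempty_basis_of_pid (Pi.basisFun O (Fin ℓ)) L
  have hpK : algebraMap O K p ≠ 0 := by
    rw [Ne, map_eq_zero_iff _ hinj]; exact hp.ne_zero
  -- the `K` side
  let f : L →ₗ[O] U :=
    { toFun := fun x => ⟨j x.1, x.2⟩
      map_add' := fun x y => Subtype.ext (by simp)
      map_smul' := fun c x => Subtype.ext (by simp) }
  have finj : Function.Injective f := by
    intro x y h
    exact Subtype.ext (jinj (congrArg Subtype.val h))
  have fli : LinearIndependent K (fun i => f (b i)) := by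
    rw [← LinearIndependent.iff_fractionRing O K]
    exact b.linearIndependent.map' f (LinearMap.ker_eq_bot.2 finj)
  have fsp : ⊤ ≤ Submodule.span K (Set.range fun i => f (b i)) := by
    rintro u -
    obtain ⟨a, ha⟩ := IsLocalization.exist_integer_multiples_of_finite (nonZeroDivisors O) u.1
    choose x hx using ha
    have hjx : j x = (a : O) • u.1 := funext hx
    have hxL : x ∈ L := by
      change j x ∈ U.restrictScalars O
      rw [hjx]
      exact Submodule.smul_mem _ _ u.2
    have haK : algebraMap O K a ≠ 0 := by
      rw [Ne, map_eq_zero_iff _ hinj]; exact nonZeroDivisors.ne_zero a.2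
    have h1 : f ⟨x, hxL⟩ ∈ Submodule.span K (Set.range fun i => f (b i)) := by
      rw [← b.sum_repr ⟨x, hxL⟩, map_sum]
      refine Submodule.sum_mem _ fun i _ => ?_
      rw [map_smul, ← algebraMap_smul K]
      exact Submodule.smul_mem _ _ (Submodule.subset_span ⟨i, rfl⟩)
    have h2 : u = (algebraMap O K a)⁻¹ • f ⟨x, hxL⟩ := by
      rw [eq_inv_smul_iff₀ haK, algebraMap_smul]
      exact Subtype.ext hjx.symm
    rw [h2]
    exact Submodule.smul_mem _ _ h1
  rw [Module.finrank_eq_card_basis (Module.Basis.mk fli fsp)]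
  -- the torsion side
  have hpf : ∀ x : L, p • ((algebraMap O K p)⁻¹ • j x.1) = j x.1 := by
    intro x
    rw [← algebraMap_smul K, smul_inv_smul₀ hpK]
  let g : L →ₗ[O] Submodule.torsionBy O (piU O U) p :=
    { toFun := fun x => ⟨⟨piMap O K ℓ ((algebraMap O K p)⁻¹ • j x.1),
          ⟨_, U.smul_mem _ x.2, rfl⟩⟩, by
        rw [Submodule.mem_torsionBy_iff]
        apply Subtype.ext
        change p • piMap O K ℓ ((algebraMap O K p)⁻¹ • j x.1) = 0
        rw [← map_smul, hpf]
        exact (piMap_eq_zero_iff _).2 ⟨x.1, rfl⟩⟩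
      map_add' := fun x y => Subtype.ext (Subtype.ext (by simp))
      map_smul' := fun c x => Subtype.ext (Subtype.ext (by
        simp only [Submodule.coe_smul, map_smul, RingHom.id_apply]
        rw [smul_comm, map_smul])) }
  have gker : ∀ x, g x = 0 → ∃ y : L, x = p • y := by
    intro x hx
    have h1 : piMap O K ℓ ((algebraMap O K p)⁻¹ • j x.1) = 0 :=
      congrArg (fun t => (t.1.1 : Fin ℓ → K ⧸ OinK O K)) hx
    obtain ⟨y, hy⟩ := (piMap_eq_zero_iff _).1 h1
    have hyL : y ∈ L := by
      change j y ∈ U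
      rw [hj, hy]
      exact U.smul_mem _ x.2
    refine ⟨⟨y, hyL⟩, Subtype.ext (jinj ?_)⟩
    change j x.1 = j (p • y)
    rw [map_smul, ← hpf x, ← hy]
  have gsurj : Function.Surjective g := by
    rintro ⟨⟨t, u, hu, rfl⟩, ht⟩
    rw [Submodule.mem_torsionBy_iff] at ht
    have h1 : piMap O K ℓ (p • u) = 0 := by
      rw [map_smul]; exact congrArg Subtype.val ht
    obtain ⟨x, hx⟩ := (piMap_eq_zero_iff _).1 h1
    have hxL : x ∈ L := by
      change j x ∈ U.restrictScalars O
      rw [hj, hx]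
      exact Submodule.smul_mem _ _ hu
    refine ⟨⟨x, hxL⟩, Subtype.ext (Subtype.ext ?_)⟩
    change piMap O K ℓ ((algebraMap O K p)⁻¹ • j x) = piMap O K ℓ u
    rw [hj, hx, ← algebraMap_smul K p u, inv_smul_smul₀ hpK]
  rw [Fintype.card_fin]
  refine finrank_aux (T := Submodule.torsionBy O (piU O U) p) p hp.not_isUnit ?_ b g gker gsurj
  exact fun a t => rfl
end
end

section
/- Let O be a residually finite Dedekind domain with fraction field K, 𝔞 a nonzero ideal of O, and S = O \ ⋃_{𝔭 | 𝔞} 𝔭 the complement of the union of the prime ideals dividing 𝔞. Then for any K-subspace U of K^ℓ, the natural map from the 𝔞-torsion submodule of π(U) ⊆ (K/O)^ℓ to the 𝔞O_S-torsion submodule of π_S(U) ⊆ (K/O_S)^ℓ, induced by the inclusion O ⊆ O_S, is an O-module isomorphism. -/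
noncomputable section

/-- The coordinatewise projection `K^ℓ → (K/N)^ℓ` for an `O`-submodule `N ⊆ K`. -/
def piMapN (O K : Type*) [CommRing O] [CommRing K] [Algebra O K] (ℓ : ℕ)
    (N : Submodule O K) : (Fin ℓ → K) →ₗ[O] (Fin ℓ → K ⧸ N) :=
  LinearMap.pi fun i => N.mkQ.comp (LinearMap.proj i)

/-- The image of a `K`-subspace `U ⊆ K^ℓ` in `(K/N)^ℓ`. -/
def piUN (O : Type*) {K : Type*} [CommRing O] [Field K] [Algebra O K] {ℓ : ℕ}
    (N : Submodule O K) (U : Submodule K (Fin ℓ → K)) : Submodule O (Fin ℓ → K ⧸ N) :=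
  (U.restrictScalars O).map (piMapN O K ℓ N)

/-- The multiplicative set `S = O \ ⋃_{𝔭 ∣ 𝔞} 𝔭`, the complement of the union of the prime
ideals dividing `𝔞`. -/
def primesCompl {O : Type*} [CommRing O] (𝔞 : Ideal O) : Submonoid O where
  carrier := {s | ∀ 𝔭 : Ideal O, 𝔭.IsPrime → 𝔭 ∣ 𝔞 → s ∉ 𝔭}
  one_mem' := fun 𝔭 hp _ h1 => hp.ne_top (Ideal.eq_top_of_isUnit_mem _ h1 isUnit_one)
  mul_mem' := fun {a b} ha hb 𝔭 hp hd hab =>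
    (hp.mem_or_mem hab).elim (ha 𝔭 hp hd) (hb 𝔭 hp hd)

/-- The localization `O_S` of `O` at a multiplicative set `S`, viewed as an `O`-submodule of
the fraction field `K`: the set of `x ∈ K` with `x·s ∈ O` for some `s ∈ S`. -/
def OSinK (O K : Type*) [CommRing O] [CommRing K] [Algebra O K] (S : Submonoid O) :
    Submodule O K where
  carrier := {x | ∃ (a s : O), s ∈ S ∧ x * algebraMap O K s = algebraMap O K a}
  zero_mem' := ⟨0, 1, S.one_mem, by simp⟩
  add_mem' := by
    rintro x y ⟨a, s, hs, h⟩ ⟨b, t, ht, h'⟩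
    refine ⟨a * t + b * s, s * t, S.mul_mem hs ht, ?_⟩
    simp only [map_mul, map_add]
    calc (x + y) * (algebraMap O K s * algebraMap O K t)
        = x * algebraMap O K s * algebraMap O K t
          + y * algebraMap O K t * algebraMap O K s := by ring
      _ = _ := by rw [h, h']
  smul_mem' := by
    rintro r x ⟨a, s, hs, h⟩
    refine ⟨r * a, s, hs, ?_⟩
    rw [Algebra.smul_def, mul_assoc, h, ← map_mul]

theorem OinK_le_OSinK (O K : Type*) [CommRing O] [CommRing K] [Algebra O K]
    (S : Submonoid O) : OinK O K ≤ OSinK O K S := by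
  rintro x ⟨a, rfl⟩
  exact ⟨a, 1, S.one_mem, by simp⟩

/-- The natural map `(K/O)^ℓ → (K/O_S)^ℓ` induced by the inclusion `O ⊆ O_S`. -/
def etaMap (O K : Type*) [CommRing O] [CommRing K] [Algebra O K] (ℓ : ℕ)
    (S : Submonoid O) : (Fin ℓ → K ⧸ OinK O K) →ₗ[O] (Fin ℓ → K ⧸ OSinK O K S) :=
  LinearMap.pi fun i =>
    (Submodule.mapQ (OinK O K) (OSinK O K S) LinearMap.id
      (OinK_le_OSinK O K S)).comp (LinearMap.proj i)

theorem aux_coprime {O : Type*} [CommRing O] [IsDedekindDomain O] (𝔞 : Ideal O) (s : O)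
    (hs : s ∈ primesCompl 𝔞) : ∃ t a : O, a ∈ 𝔞 ∧ t * s + a = 1 := by
  have h : Ideal.span {s} ⊔ 𝔞 = ⊤ := by
    by_contra h
    obtain ⟨m, hm, hle⟩ := Ideal.exists_le_maximal _ h
    refine hs m hm.isPrime (Ideal.dvd_iff_le.mpr (le_sup_right.trans hle)) ?_
    exact hle (Ideal.mem_sup_left (Ideal.mem_span_singleton_self s))
  have h1 : (1 : O) ∈ Ideal.span {s} ⊔ 𝔞 := by rw [h]; trivial
  obtain ⟨y, hy, a, ha, hya⟩ := Submodule.mem_sup.mp h1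
  obtain ⟨t, rfl⟩ := Ideal.mem_span_singleton'.mp hy
  exact ⟨t, a, ha, hya⟩

theorem mem_OSinK_iff {O K : Type*} [CommRing O] [CommRing K] [Algebra O K] (S : Submonoid O)
    (x : K) : x ∈ OSinK O K S ↔ ∃ s ∈ S, s • x ∈ OinK O K := by
  constructor
  · rintro ⟨a, s, hs, h⟩
    exact ⟨s, hs, a, by rw [Algebra.smul_def, mul_comm, h]; rfl⟩
  · rintro ⟨s, hs, a, h⟩
    exact ⟨a, s, hs, by rw [mul_comm, ← Algebra.smul_def, ← h]; rfl⟩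

theorem aux_common {O K : Type*} [CommRing O] [CommRing K] [Algebra O K] (S : Submonoid O)
    (T : Finset K) (hT : ∀ x ∈ T, x ∈ OSinK O K S) :
    ∃ s ∈ S, ∀ x ∈ T, s • x ∈ OinK O K := by
  classical
  induction T using Finset.induction_on with
  | empty => exact ⟨1, S.one_mem, by simp⟩
  | insert x T _ ih =>
    obtain ⟨s, hs, h⟩ := ih fun y hy => hT y (Finset.mem_insert_of_mem hy)
    obtain ⟨t, ht, h'⟩ := (mem_OSinK_iff S x).mp (hT x (Finset.mem_insert_self _ _))
    refine ⟨s * t, S.mul_mem hs ht, fun y hy => ?_⟩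
    rcases Finset.mem_insert.mp hy with rfl | hy
    · rw [mul_smul]; exact Submodule.smul_mem _ _ h'
    · rw [mul_comm, mul_smul]; exact Submodule.smul_mem _ _ (h y hy)

theorem piMapN_eq_zero {O K : Type*} [CommRing O] [CommRing K] [Algebra O K] {ℓ : ℕ}
    (N : Submodule O K) (u : Fin ℓ → K) : piMapN O K ℓ N u = 0 ↔ ∀ i, u i ∈ N := by
  rw [funext_iff]
  exact forall_congr' fun i => Submodule.Quotient.mk_eq_zero N

/-- For a residually finite Dedekind domain `O` with fraction field `K`, a nonzero ideal `𝔞`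
and `S = O \ ⋃_{𝔭 ∣ 𝔞} 𝔭`, the natural map `(K/O)^ℓ → (K/O_S)^ℓ` restricts to a bijection
(hence an `O`-module isomorphism) from the `𝔞`-torsion part of `π(U)` onto the
`𝔞O_S`-torsion part of `π_S(U)` (an element of `(K/O_S)^ℓ` is `𝔞O_S`-torsion iff it is killed
by every `a ∈ 𝔞`, since `𝔞` generates `𝔞O_S`). -/
theorem stmt4 {O K : Type*} [CommRing O] [IsDomain O] [IsDedekindDomain O]
    [Field K] [Algebra O K] [IsFractionRing O K]
    (hres : ∀ I : Ideal O, I ≠ ⊥ → Finite (O ⧸ I))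
    (ℓ : ℕ) (𝔞 : Ideal O) (h𝔞 : 𝔞 ≠ ⊥) (U : Submodule K (Fin ℓ → K)) :
    Set.BijOn (etaMap O K ℓ (primesCompl 𝔞))
      {x | x ∈ piUN O (OinK O K) U ∧ ∀ a ∈ 𝔞, a • x = 0}
      {y | y ∈ piUN O (OSinK O K (primesCompl 𝔞)) U ∧ ∀ a ∈ 𝔞, a • y = 0} := by
  classical
  have heta : ∀ u : Fin ℓ → K, etaMap O K ℓ (primesCompl 𝔞) (piMapN O K ℓ (OinK O K) u)
      = piMapN O K ℓ (OSinK O K (primesCompl 𝔞)) u := fun u => rfl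
  refine ⟨?_, ?_, ?_⟩
  · rintro x ⟨⟨u, hu, rfl⟩, hx⟩
    refine ⟨⟨u, hu, rfl⟩, fun a ha => ?_⟩
    rw [← map_smul, hx a ha, map_zero]
  · rintro x ⟨⟨u, hu, rfl⟩, hx⟩ y ⟨⟨v, hv, rfl⟩, hy⟩ hxy
    rw [heta, heta, ← sub_eq_zero, ← map_sub, piMapN_eq_zero] at hxy
    rw [← sub_eq_zero, ← map_sub, piMapN_eq_zero]
    intro i
    obtain ⟨s, hs, h⟩ := (mem_OSinK_iff _ _).mp (hxy i)
    obtain ⟨t, a, ha, hta⟩ := aux_coprime 𝔞 s hs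
    have h2 : a • piMapN O K ℓ (OinK O K) (u - v) = 0 := by
      rw [map_sub, smul_sub, hx a ha, hy a ha, sub_zero]
    rw [← map_smul, piMapN_eq_zero] at h2
    rw [← one_smul O ((u - v) i), ← hta, add_smul, mul_smul]
    exact Submodule.add_mem _ (Submodule.smul_mem _ _ h) (h2 i)
  · rintro y ⟨⟨u, hu, rfl⟩, hy⟩
    have hy' : ∀ a ∈ 𝔞, ∀ i, a • u i ∈ OSinK O K (primesCompl 𝔞) := fun a ha => by
      have := hy a ha
      rw [← map_smul, piMapN_eq_zero] at this
      exact this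
    obtain ⟨G, hG⟩ := (IsNoetherian.noetherian 𝔞 : 𝔞.FG)
    obtain ⟨s, hs, h⟩ := aux_common (primesCompl 𝔞)
      ((G ×ˢ (Finset.univ : Finset (Fin ℓ))).image fun p => p.1 • u p.2) (by
        intro x hx
        obtain ⟨p, hp, rfl⟩ := Finset.mem_image.mp hx
        exact hy' _ (hG ▸ Submodule.subset_span (Finset.mem_product.mp hp).1) _)
    have hall : ∀ a ∈ 𝔞, ∀ i, s • a • u i ∈ OinK O K := by
      intro a ha i
      rw [← hG] at ha
      induction ha using Submodule.span_induction with
      | mem g hg =>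
        exact h _ (Finset.mem_image.mpr
          ⟨(g, i), Finset.mem_product.mpr ⟨hg, Finset.mem_univ _⟩, rfl⟩)
      | zero => simp
      | add a b _ _ h1 h2 => rw [add_smul, smul_add]; exact Submodule.add_mem _ h1 h2
      | smul r a _ h1 =>
        rw [smul_assoc, smul_comm]; exact Submodule.smul_mem _ _ h1
    obtain ⟨t, a, ha, hta⟩ := aux_coprime 𝔞 s hs
    refine ⟨piMapN O K ℓ (OinK O K) ((t * s) • u),
      ⟨⟨_, (U.restrictScalars O).smul_mem _ hu, rfl⟩, fun b hb => ?_⟩, ?_⟩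
    · rw [← map_smul, piMapN_eq_zero]
      intro i
      have : (b • (t * s) • u) i = t • s • b • u i := by
        simp only [Pi.smul_apply, smul_smul]
        congr 1
        ring
      rw [this]
      exact Submodule.smul_mem _ _ (hall b hb i)
    · have : (t * s) • u = u - a • u := by
        rw [eq_sub_iff_add_eq, ← add_smul, hta, one_smul]
      rw [heta, this, map_sub, map_smul, hy a ha, sub_zero]
end
end

section
/- Let O be a residually finite Dedekind domain with fraction field K, let 𝔞 be a nonzero ideal of O, and let H ⊆ K^ℓ be a K-subspace. If Z = π(u) + π(H) is a coset of π(H) in (K/O)^ℓ that contains an 𝔞-torsion element of (K/O)^ℓ, then the number of 𝔞-torsion elements of (K/O)^ℓ contained in Z equals N(𝔞)^{dim_K H}, where N(𝔞) = #(O/𝔞). -/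
noncomputable section

/-- The coset `Z = π(u) + π(H)` in `(K/O)^ℓ`. -/
def coset (O : Type*) {K : Type*} [CommRing O] [Field K] [Algebra O K] {ℓ : ℕ}
    (H : Submodule K (Fin ℓ → K)) (u : Fin ℓ → K) : Set (Fin ℓ → K ⧸ OinK O K) :=
  {x | ∃ h ∈ (H.restrictScalars O).map (piMap O K ℓ), x = piMap O K ℓ u + h}

open TensorProduct in
lemma card_quot_smul_top {O M : Type*} [CommRing O] [IsDomain O] [IsDedekindDomain O]
    [AddCommGroup M] [Module O M] [Module.Finite O M] [Module.IsTorsionFree O M]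
    (𝔞 : Ideal O) (hfin : Finite (O ⧸ 𝔞)) :
    Nat.card (M ⧸ (𝔞 • (⊤ : Submodule O M))) = Nat.card (O ⧸ 𝔞) ^ Module.finrank O M := by
  rw [← Nat.card_congr (TensorProduct.quotTensorEquivQuotSMul M 𝔞).toEquiv]
  have hS : Finite (MaximalSpectrum (O ⧸ 𝔞)) := by
    have : IsArtinianRing (O ⧸ 𝔞) := inferInstance
    infer_instance
  obtain ⟨b⟩ := Module.nonempty_basis_of_flat_of_finrank_eq (O ⧸ 𝔞) ((O ⧸ 𝔞) ⊗[O] M)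
    (Module.finrank O M) (by
      intro P
      have hP := P.isMaximal
      letI : Field ((O ⧸ 𝔞) ⧸ P.asIdeal) := Ideal.Quotient.field _
      rw [(AlgebraTensorModule.cancelBaseChange O (O ⧸ 𝔞) ((O ⧸ 𝔞) ⧸ P.asIdeal)
        ((O ⧸ 𝔞) ⧸ P.asIdeal) M).finrank_eq]
      let q : PrimeSpectrum ((O ⧸ 𝔞) ⧸ P.asIdeal) := ⟨⊥, Ideal.isPrime_bot⟩
      have h1 := Module.rankAtStalk_baseChange (R := O) (M := M) q
      have h2 := congrFun (Module.rankAtStalk_eq_finrank_of_free (R := (O ⧸ 𝔞) ⧸ P.asIdeal)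
        (M := ((O ⧸ 𝔞) ⧸ P.asIdeal) ⊗[O] M)) q
      rw [h1] at h2
      have h3 := Ideal.finrank_fiber_eq_finrank (M := M) (PrimeSpectrum.comap (algebraMap O _) q).asIdeal
      rw [← h3, Ideal.finrank_fiber_eq_rankAtStalk]
      exact h2.symm)
  rw [Nat.card_congr b.equivFun.toEquiv, Nat.card_fun]
  simp

lemma piMap_eq_zero {O K : Type*} [CommRing O] [CommRing K] [Algebra O K] {ℓ : ℕ}
    (v : Fin ℓ → K) : piMap O K ℓ v = 0 ↔ ∃ w : Fin ℓ → O, ∀ i, algebraMap O K (w i) = v i := by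
  rw [← Classical.skolem (p := fun i x => algebraMap O K x = v i), funext_iff]
  refine forall_congr' fun i => ?_
  change (OinK O K).mkQ (v i) = 0 ↔ _
  rw [Submodule.mkQ_apply, Submodule.Quotient.mk_eq_zero]
  simp [OinK]

lemma ker_piMap_fg {O K : Type*} [CommRing O] [CommRing K] [Algebra O K] {ℓ : ℕ} :
    Module.Finite O (LinearMap.ker (piMap O K ℓ)) := by
  have : LinearMap.ker (piMap O K ℓ) = LinearMap.range
      (LinearMap.pi fun i => (Algebra.linearMap O K).comp (LinearMap.proj i) :
        (Fin ℓ → O) →ₗ[O] (Fin ℓ → K)) := by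
    ext v
    rw [LinearMap.mem_ker, piMap_eq_zero]
    simp [funext_iff]
  rw [this]
  infer_instance

/-- elements of `H` whose image is `𝔞`-torsion -/
def torsLift {O K : Type*} [CommRing O] [Field K] [Algebra O K] {ℓ : ℕ}
    (𝔞 : Ideal O) (H : Submodule K (Fin ℓ → K)) : Submodule O (Fin ℓ → K) where
  carrier := {v | v ∈ H ∧ ∀ a ∈ 𝔞, piMap O K ℓ (a • v) = 0}
  zero_mem' := ⟨H.zero_mem, by simp⟩
  add_mem' := fun {x y} hx hy => ⟨H.add_mem hx.1 hy.1, fun a ha => by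
    rw [smul_add, map_add, hx.2 a ha, hy.2 a ha, add_zero]⟩
  smul_mem' := fun r x hx => ⟨(H.restrictScalars O).smul_mem r hx.1, fun a ha => by
    rw [smul_comm, map_smul, hx.2 a ha, smul_zero]⟩

section
variable {O K : Type*} [CommRing O] [IsDomain O] [IsDedekindDomain O]
    [Field K] [Algebra O K] [IsFractionRing O K] {ℓ : ℕ} {𝔞 : Ideal O} (h𝔞 : 𝔞 ≠ ⊥)
    (H : Submodule K (Fin ℓ → K))

lemma torsLift_finite (h𝔞 : 𝔞 ≠ ⊥) : Module.Finite O (torsLift 𝔞 H) := by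
  obtain ⟨c, hc, hc0⟩ := Submodule.exists_mem_ne_zero_of_ne_bot h𝔞
  have := ker_piMap_fg (O := O) (K := K) (ℓ := ℓ)
  have : IsNoetherian O (LinearMap.ker (piMap O K ℓ)) := inferInstance
  let f : torsLift 𝔞 H →ₗ[O] LinearMap.ker (piMap O K ℓ) :=
    ((LinearMap.lsmul O (Fin ℓ → K) c).comp (torsLift 𝔞 H).subtype).codRestrict _
      (fun v => v.2.2 c hc)
  refine Module.Finite.of_injective f ?_
  intro x y hxy
  have h : c • (x : Fin ℓ → K) = c • (y : Fin ℓ → K) := congrArg Subtype.val hxy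
  have hI : Module.IsTorsionFree O (Fin ℓ → K) := .trans_faithfulSMul O K _
  exact Subtype.ext (smul_right_injective _ hc0 h)

lemma mem_torsLift_of_integral {v : Fin ℓ → K} (hv : v ∈ H) (h0 : piMap O K ℓ v = 0) :
    v ∈ torsLift 𝔞 H :=
  ⟨hv, fun a _ => by rw [map_smul, h0, smul_zero]⟩

lemma integral_mem (h𝔞 : 𝔞 ≠ ⊥) {v : Fin ℓ → K} (hv : v ∈ H) (h0 : piMap O K ℓ v = 0) :
    v ∈ 𝔞 • torsLift 𝔞 H := by
  obtain ⟨c, hc, hc0⟩ := Submodule.exists_mem_ne_zero_of_ne_bot h𝔞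
  obtain ⟨𝔟, h𝔟⟩ : 𝔞 ∣ Ideal.span {c} := Ideal.dvd_iff_le.2 (by simpa using hc)
  have hcK : algebraMap O K c ≠ 0 := by simpa using hc0
  set w : Fin ℓ → K := (algebraMap O K c)⁻¹ • v with hw
  have hwv : c • w = v := by
    rw [hw, ← algebraMap_smul K c, smul_smul, mul_inv_cancel₀ hcK, one_smul]
  have hwH : w ∈ H := H.smul_mem _ hv
  have key : 𝔟 • Submodule.span O {w} ≤ torsLift 𝔞 H := by
    rw [Submodule.smul_le]
    intro b hb x hx
    obtain ⟨r, rfl⟩ := Submodule.mem_span_singleton.1 hx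
    rw [smul_comm]
    refine Submodule.smul_mem _ _ ⟨(H.restrictScalars O).smul_mem b hwH, fun a ha => ?_⟩
    have : a * b ∈ Ideal.span {c} := h𝔟 ▸ Ideal.mul_mem_mul ha hb
    obtain ⟨s, hs⟩ := Ideal.mem_span_singleton'.1 this
    rw [smul_smul, ← hs, mul_smul, hwv, map_smul, h0, smul_zero]
  have h1 : c • w ∈ (𝔞 * 𝔟) • Submodule.span O {w} :=
    Submodule.smul_mem_smul (h𝔟 ▸ Ideal.mem_span_singleton_self c)
      (Submodule.mem_span_singleton_self w)
  rw [hwv, ← smul_eq_mul, Submodule.smul_assoc] at h1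
  exact Submodule.smul_mono le_rfl key h1

lemma finrank_torsLift (h𝔞 : 𝔞 ≠ ⊥) : Module.finrank O (torsLift 𝔞 H) = Module.finrank K H := by
  rw [IsFractionRing.finrank_right_eq O K H]
  let f : torsLift 𝔞 H →ₗ[O] H :=
    (torsLift 𝔞 H).subtype.codRestrict (H.restrictScalars O) (fun v => v.2.1)
  have hI : Module.IsTorsionFree O H := .trans_faithfulSMul O K _
  have hloc : IsLocalizedModule (nonZeroDivisors O) f := by
    refine ⟨fun s => ?_, fun y => ?_, fun {x y} hxy => ⟨1, ?_⟩⟩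
    · have hs : algebraMap O K s ≠ 0 := by simp
      rw [Module.End.isUnit_iff]
      refine ⟨fun x y hxy => smul_right_injective _ (nonZeroDivisors.ne_zero s.2) hxy,
        fun y => ⟨(algebraMap O K s)⁻¹ • y, ?_⟩⟩
      rw [Module.algebraMap_end_apply, ← algebraMap_smul K (s : O), smul_smul,
        mul_inv_cancel₀ hs, one_smul]
    · obtain ⟨d, hd⟩ := IsLocalization.exist_integer_multiples_of_finite (nonZeroDivisors O)
        (y : Fin ℓ → K)
      have h0 : piMap O K ℓ ((d : O) • (y : Fin ℓ → K)) = 0 := by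
        rw [piMap_eq_zero]
        choose w hw using hd
        exact ⟨w, hw⟩
      exact ⟨(⟨_, mem_torsLift_of_integral H ((H.restrictScalars O).smul_mem (d : O) y.2) h0⟩, d),
        Subtype.ext rfl⟩
    · have h : (x : Fin ℓ → K) = y := congrArg (fun z : H => (z : Fin ℓ → K)) hxy
      rw [Subtype.ext h]
  exact (IsLocalizedModule.finrank_eq (nonZeroDivisors O) f le_rfl).symm

lemma card_tors (h𝔞 : 𝔞 ≠ ⊥) (hfin : Finite (O ⧸ 𝔞)) :
    Nat.card {x : Fin ℓ → K ⧸ OinK O K //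
      x ∈ (H.restrictScalars O).map (piMap O K ℓ) ∧ ∀ a ∈ 𝔞, a • x = 0} =
      Nat.card (O ⧸ 𝔞) ^ Module.finrank K H := by
  have := torsLift_finite H h𝔞
  have hI : Module.IsTorsionFree O (Fin ℓ → K) := .trans_faithfulSMul O K _
  rw [← finrank_torsLift H h𝔞, ← card_quot_smul_top 𝔞 hfin]
  let g := (piMap O K ℓ).comp (torsLift 𝔞 H).subtype
  have hker : LinearMap.ker g = 𝔞 • (⊤ : Submodule O (torsLift 𝔞 H)) := by
    apply Submodule.map_injective_of_injective (torsLift 𝔞 H).injective_subtype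
    rw [Submodule.map_smul'', Submodule.map_top, Submodule.range_subtype]
    apply le_antisymm
    · rintro _ ⟨v, hv, rfl⟩
      exact integral_mem H h𝔞 v.2.1 hv
    · rw [Submodule.smul_le]
      intro a ha v hv
      exact ⟨a • ⟨v, hv⟩, hv.2 a ha, rfl⟩
  rw [← hker, Nat.card_congr g.quotKerEquivRange.toEquiv]
  refine Nat.card_congr (Equiv.subtypeEquivRight fun x => ?_)
  constructor
  · rintro ⟨⟨v, hv, rfl⟩, h⟩
    exact ⟨⟨v, hv, fun a ha => by rw [map_smul, h a ha]⟩, rfl⟩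
  · rintro ⟨v, rfl⟩
    exact ⟨⟨v, v.2.1, rfl⟩, fun a ha => by
      have := v.2.2 a ha
      rwa [map_smul] at this⟩
end

/-- For a residually finite Dedekind domain `O` with fraction field `K`, a nonzero ideal `𝔞`
and a `K`-subspace `H ⊆ K^ℓ`: if the coset `Z = π(u) + π(H)` contains an `𝔞`-torsion element
of `(K/O)^ℓ`, then the number of `𝔞`-torsion elements of `(K/O)^ℓ` lying in `Z` is
`N(𝔞)^{dim_K H}` where `N(𝔞) = #(O/𝔞)`. -/
theorem stmt5 {O K : Type*} [CommRing O] [IsDomain O] [IsDedekindDomain O]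
    [Field K] [Algebra O K] [IsFractionRing O K]
    (hres : ∀ I : Ideal O, I ≠ ⊥ → Finite (O ⧸ I))
    (ℓ : ℕ) (𝔞 : Ideal O) (h𝔞 : 𝔞 ≠ ⊥)
    (H : Submodule K (Fin ℓ → K)) (u : Fin ℓ → K)
    (hne : ∃ x ∈ coset O H u, ∀ a ∈ 𝔞, a • x = 0) :
    Nat.card {x : Fin ℓ → K ⧸ OinK O K // x ∈ coset O H u ∧ ∀ a ∈ 𝔞, a • x = 0} =
      Nat.card (O ⧸ 𝔞) ^ Module.finrank K H := by
  obtain ⟨x₀, ⟨h₀, hh₀, hx₀⟩, ht₀⟩ := hne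
  rw [← card_tors H h𝔞 (hres 𝔞 h𝔞)]
  refine Nat.card_congr ((Equiv.subRight x₀).subtypeEquiv fun x => ?_)
  simp only [Equiv.subRight_apply]
  constructor
  · rintro ⟨⟨h, hh, rfl⟩, ht⟩
    refine ⟨?_, fun a ha => by rw [smul_sub, ht a ha, ht₀ a ha, sub_zero]⟩
    rw [hx₀, add_sub_add_left_eq_sub]
    exact Submodule.sub_mem _ hh hh₀
  · rintro ⟨h, ht⟩
    refine ⟨⟨(x - x₀) + h₀, Submodule.add_mem _ h hh₀, by rw [hx₀]; abel⟩, fun a ha => ?_⟩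
    have := ht a ha
    rwa [smul_sub, ht₀ a ha, sub_zero] at this
end
end

section
/- Let O be a Dedekind domain with fraction field K, 𝔞 a nonzero ideal, and J = {α_{j_1},…,α_{j_k}} ⊆ O^ℓ a finite set of nonzero vectors. Set H_{J,K} = {u ∈ K^ℓ : u·α = 0 for all α ∈ J} and let π : K^ℓ → (K/O)^ℓ be the projection. If the coset Z = π(u) + π(H_{J,K}) (with u·α ∈ O for all α ∈ J) satisfies 𝔞·Z ⊆ π(H_{J,K}) (i.e., Z is an 𝔞-torsion element of the quotient module), then Z contains an element π(z) with z ∈ K^ℓ such that a·z ∈ O^ℓ for all a ∈ 𝔞. -/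
noncomputable section

/-- The linear form `u ↦ u·α` on `K^ℓ` given by a vector `α ∈ O^ℓ`. -/
def dotForm (O K : Type*) [CommRing O] [Field K] [Algebra O K] (ℓ : ℕ)
    (α : Fin ℓ → O) : (Fin ℓ → K) →ₗ[K] K :=
  ∑ i, algebraMap O K (α i) • LinearMap.proj i

/-- `H_{J,K} = {u ∈ K^ℓ : u·α = 0 for all α ∈ J}`. -/
def HJK (O K : Type*) [CommRing O] [Field K] [Algebra O K] (ℓ : ℕ)
    (J : Finset (Fin ℓ → O)) : Submodule K (Fin ℓ → K) :=
  ⨅ α ∈ J, LinearMap.ker (dotForm O K ℓ α)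

theorem dotForm_coe {O K : Type*} [CommRing O] [Field K] [Algebra O K] (ℓ : ℕ)
    (α v : Fin ℓ → O) :
    dotForm O K ℓ α (fun i => algebraMap O K (v i)) = algebraMap O K (α ⬝ᵥ v) := by
  simp [dotForm, dotProduct, LinearMap.sum_apply, Algebra.smul_def]

theorem mem_HJK {O K : Type*} [CommRing O] [Field K] [Algebra O K] (ℓ : ℕ)
    (J : Finset (Fin ℓ → O)) (x : Fin ℓ → K) :
    x ∈ HJK O K ℓ J ↔ ∀ α ∈ J, dotForm O K ℓ α x = 0 := by
  simp [HJK, Submodule.mem_iInf]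

theorem exists_q {O : Type*} [CommRing O] [IsDomain O] [IsDedekindDomain O] (ℓ : ℕ)
    (J : Finset (Fin ℓ → O)) :
    ∃ q : (Fin ℓ → O) →ₗ[O] (Fin ℓ → O), (∀ v, (∀ α ∈ J, α ⬝ᵥ v = 0) → q v = 0) ∧
      ∀ v, ∀ α ∈ J, α ⬝ᵥ (q v) = α ⬝ᵥ v := by
  let D : (Fin ℓ → O) →ₗ[O] (J → O) := LinearMap.pi fun α => dotProductBilin O O α.1
  have hfp : Module.FinitePresentation O (LinearMap.range D) :=
    Module.finitePresentation_of_finite O _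
  have : Module.Projective O (LinearMap.range D) := Module.Flat.projective_of_finitePresentation
  obtain ⟨s, hs⟩ := D.rangeRestrict.exists_rightInverse_of_surjective D.range_rangeRestrict
  refine ⟨s ∘ₗ D.rangeRestrict, fun v hv => ?_, fun v α hα => ?_⟩
  · have : D.rangeRestrict v = 0 := by
      apply Subtype.ext
      funext α
      exact hv α.1 α.2
    simp [this]
  · have h := LinearMap.congr_fun hs (D.rangeRestrict v)
    exact congrFun (congrArg Subtype.val h) ⟨α, hα⟩

theorem exists_p {O K : Type*} [CommRing O] [IsDomain O] [IsDedekindDomain O]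
    [Field K] [Algebra O K] [IsFractionRing O K] (ℓ : ℕ) (J : Finset (Fin ℓ → O)) :
    ∃ p : (Fin ℓ → K) →ₗ[K] (Fin ℓ → K), (∀ x ∈ HJK O K ℓ J, p x = 0) ∧
      (∀ x, p x - x ∈ HJK O K ℓ J) ∧
      ∀ v : Fin ℓ → O, ∃ w : Fin ℓ → O,
        p (fun i => algebraMap O K (v i)) = fun i => algebraMap O K (w i) := by
  obtain ⟨q, hq0, hq1⟩ := exists_q ℓ J
  let p : (Fin ℓ → K) →ₗ[K] (Fin ℓ → K) :=
    Matrix.toLin' ((LinearMap.toMatrix' q).map (algebraMap O K))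
  have hp : ∀ v : Fin ℓ → O,
      p (fun i => algebraMap O K (v i)) = fun i => algebraMap O K (q v i) := by
    intro v
    funext i
    have := RingHom.map_mulVec (algebraMap O K) (LinearMap.toMatrix' q) v i
    rw [LinearMap.toMatrix'_mulVec] at this
    rw [this]
    rfl
  have hcl : ∀ x : Fin ℓ → K, ∃ d : K, d ≠ 0 ∧ ∃ v : Fin ℓ → O,
      d • x = fun i => algebraMap O K (v i) := by
    intro x
    obtain ⟨b, hb⟩ := IsLocalization.exist_integer_multiples_of_finite (nonZeroDivisors O) x
    choose v hv using hb
    refine ⟨algebraMap O K b, IsFractionRing.to_map_ne_zero_of_mem_nonZeroDivisors b.2, v, ?_⟩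
    funext i
    rw [hv i, Pi.smul_apply, algebraMap_smul]
  refine ⟨p, fun x hx => ?_, fun x => ?_, fun v => ⟨q v, hp v⟩⟩
  · obtain ⟨d, hd, v, hv⟩ := hcl x
    have h2 := (HJK O K ℓ J).smul_mem d hx
    rw [hv, mem_HJK] at h2
    have h3 : q v = 0 := hq0 v fun α hα => by
      have := h2 α hα
      rw [dotForm_coe] at this
      exact (IsFractionRing.injective O K) (by simpa using this)
    have h4 : d • p x = 0 := by
      rw [← map_smul, hv, hp, h3]
      funext i
      simp
    exact (smul_eq_zero.mp h4).resolve_left hd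
  · obtain ⟨d, hd, v, hv⟩ := hcl x
    rw [← Submodule.smul_mem_iff _ hd, smul_sub, ← map_smul, hv, hp, mem_HJK]
    intro α hα
    rw [map_sub, dotForm_coe, dotForm_coe, hq1 v α hα, sub_self]

/-- For a Dedekind domain `O` with fraction field `K`, a nonzero ideal `𝔞`, and a finite set
`J` of nonzero vectors in `O^ℓ`: if the coset `Z = π(u) + π(H_{J,K})` (with `u·α ∈ O` for all
`α ∈ J`) is 𝔞-torsion, i.e. `𝔞·Z ⊆ π(H_{J,K})`, then `Z` contains an element `π(z)` with
`a·z ∈ O^ℓ` for all `a ∈ 𝔞`. -/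
theorem stmt6 {O K : Type*} [CommRing O] [IsDomain O] [IsDedekindDomain O]
    [Field K] [Algebra O K] [IsFractionRing O K]
    (ℓ : ℕ) (𝔞 : Ideal O) (h𝔞 : 𝔞 ≠ ⊥)
    (J : Finset (Fin ℓ → O)) (hJ : ∀ α ∈ J, α ≠ 0)
    (u : Fin ℓ → K) (hu : ∀ α ∈ J, dotForm O K ℓ α u ∈ OinK O K)
    (htor : ∀ a ∈ 𝔞, a • piMap O K ℓ u ∈
      ((HJK O K ℓ J).restrictScalars O).map (piMap O K ℓ)) :
    ∃ z : Fin ℓ → K,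
      piMap O K ℓ z - piMap O K ℓ u ∈
        ((HJK O K ℓ J).restrictScalars O).map (piMap O K ℓ) ∧
      ∀ a ∈ 𝔞, ∀ i, ∃ c : O, a • z i = algebraMap O K c := by
  obtain ⟨p, hp0, hp1, hp2⟩ := exists_p (K := K) ℓ J
  refine ⟨p u, ⟨p u - u, hp1 u, map_sub _ _ _⟩, fun a ha i => ?_⟩
  obtain ⟨x, hx, hxu⟩ := htor a ha
  rw [← map_smul] at hxu
  have hint : ∀ i, ∃ c : O, algebraMap O K c = (a • u - x) i := by
    intro i
    have h := congrFun hxu.symm i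
    exact (Submodule.Quotient.eq (OinK O K)).mp h
  choose v hv using hint
  obtain ⟨w, hw⟩ := hp2 v
  refine ⟨w i, ?_⟩
  have e : (fun i => algebraMap O K (v i)) = a • u - x := funext hv
  rw [e, map_sub, hp0 x hx, sub_zero, ← algebraMap_smul K a u, map_smul] at hw
  rw [← congrFun hw i, Pi.smul_apply, algebraMap_smul]
end
end

section
/- Let C be a linear code (𝔽_q-subspace) of 𝔽_q^n with generator matrix G = (α_1 ⋯ α_n) ∈ Mat_{ℓ×n}(𝔽_q) such that the map u ↦ uG is injective with image C and no two columns α_i, α_j (i ≠ j) are scalar multiples of each other. Let 𝒜_G = {H_{α_1},…,H_{α_n}} be the arrangement of hyperplanes H_{α_i} = {u ∈ 𝔽_q^ℓ : u·α_i = 0} in 𝔽_q^ℓ. Then the coboundary polynomial of 𝒜_G evaluated at (q, x) equals W_C(x, 1) = Σ_{c ∈ C} x^{n − wt(c)}, where wt is the Hamming weight. -/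
noncomputable section

open scoped Classical

/-- The hyperplane `H_α = {u : u·α = 0}` in `F^ℓ`. -/
def Hyp (F : Type*) [Field F] (ℓ : ℕ) (α : Fin ℓ → F) : Submodule F (Fin ℓ → F) :=
  LinearMap.ker (∑ i, α i • (LinearMap.proj i : (Fin ℓ → F) →ₗ[F] F))

/-- The intersection lattice of the arrangement with hyperplanes `H_{α j}`: all intersections
of subfamilies (the empty intersection being the ambient space `F^ℓ`). -/
def interLattice (F : Type*) [Field F] (ℓ n : ℕ) (α : Fin n → Fin ℓ → F) :
    Finset (Submodule F (Fin ℓ → F)) :=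
  (Finset.univ : Finset (Finset (Fin n))).image fun s => ⨅ j ∈ s, Hyp F ℓ (α j)

/-- `a(X)`: the number of hyperplanes of the arrangement containing `X`. -/
def numAtoms (F : Type*) [Field F] (ℓ n : ℕ) (α : Fin n → Fin ℓ → F)
    (X : Submodule F (Fin ℓ → F)) : ℕ :=
  (Finset.univ.filter fun j : Fin n => X ≤ Hyp F ℓ (α j)).card

/-- The Hamming weight of `c ∈ F^n`. -/
def hamWt {F : Type*} [Field F] {n : ℕ} (c : Fin n → F) : ℕ :=
  (Finset.univ.filter fun j : Fin n => c j ≠ 0).card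

lemma mem_Hyp_iff (F : Type*) [Field F] (ℓ : ℕ) (a u : Fin ℓ → F) :
    u ∈ Hyp F ℓ a ↔ ∑ i, u i * a i = 0 := by
  simp [Hyp, LinearMap.sum_apply, mul_comm]

/-- The smallest flat containing `u`. -/
def flatOf (F : Type*) [Field F] (ℓ n : ℕ) (α : Fin n → Fin ℓ → F) (u : Fin ℓ → F) :
    Submodule F (Fin ℓ → F) :=
  ⨅ j ∈ Finset.univ.filter (fun j : Fin n => u ∈ Hyp F ℓ (α j)), Hyp F ℓ (α j)

lemma flatOf_mem (F : Type*) [Field F] (ℓ n : ℕ) (α : Fin n → Fin ℓ → F) (u : Fin ℓ → F) :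
    flatOf F ℓ n α u ∈ interLattice F ℓ n α :=
  Finset.mem_image_of_mem _ (Finset.mem_univ _)

lemma self_mem_flatOf (F : Type*) [Field F] (ℓ n : ℕ) (α : Fin n → Fin ℓ → F)
    (u : Fin ℓ → F) : u ∈ flatOf F ℓ n α u := by
  simp [flatOf, Submodule.mem_iInf]

lemma flatOf_le_Hyp (F : Type*) [Field F] (ℓ n : ℕ) (α : Fin n → Fin ℓ → F)
    (u : Fin ℓ → F) (j : Fin n) : flatOf F ℓ n α u ≤ Hyp F ℓ (α j) ↔ u ∈ Hyp F ℓ (α j) := by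
  refine ⟨fun h => h (self_mem_flatOf F ℓ n α u), fun h => ?_⟩
  exact iInf₂_le j (by simp [h])

lemma flatOf_le_iff (F : Type*) [Field F] (ℓ n : ℕ) (α : Fin n → Fin ℓ → F)
    (u : Fin ℓ → F) (Y : Submodule F (Fin ℓ → F)) (hY : Y ∈ interLattice F ℓ n α) :
    flatOf F ℓ n α u ≤ Y ↔ u ∈ Y := by
  refine ⟨fun h => h (self_mem_flatOf F ℓ n α u), fun h => ?_⟩
  obtain ⟨s, -, rfl⟩ := Finset.mem_image.1 hY
  simp only [Submodule.mem_iInf] at h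
  exact le_iInf₂ fun j hj => (flatOf_le_Hyp F ℓ n α u j).2 (h j hj)

lemma numAtoms_flatOf (F : Type*) [Field F] (ℓ n : ℕ) (α : Fin n → Fin ℓ → F)
    (u : Fin ℓ → F) : numAtoms F ℓ n α (flatOf F ℓ n α u) =
      n - hamWt (fun j : Fin n => ∑ i, u i * α j i) := by
  unfold numAtoms hamWt
  simp only [flatOf_le_Hyp, mem_Hyp_iff]
  have h := Finset.card_filter_add_card_filter_not (s := (Finset.univ : Finset (Fin n)))
    (fun j : Fin n => ∑ i, u i * α j i = 0)
  rw [Finset.card_univ, Fintype.card_fin] at h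
  simp only [ne_eq]
  omega

/-- Greene's theorem: for a linear code `C ⊆ 𝔽_q^n` with generator matrix `G` (columns
`α j`; injective encoding map `u ↦ uG` with image `C`; pairwise non-proportional nonzero
columns), the coboundary polynomial of the arrangement `𝒜_G` evaluated at `t = q = #F`
equals `W_C(x,1) = Σ_{c∈C} x^{n−wt c}`.  In the intersection lattice, ordered by reverse
inclusion, `Y ≥ X` means `Y ⊆ X` as submodules; `μ` is the Möbius function of this lattice,
specified by its defining recursion. -/
theorem stmt12 (F : Type*) [Field F] [Fintype F] (ℓ n : ℕ)
    (α : Fin n → Fin ℓ → F) (hα : ∀ j, α j ≠ 0)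
    (hpar : ∀ j j', j ≠ j' → ∀ k : F, α j ≠ k • α j')
    (hinj : Function.Injective fun (u : Fin ℓ → F) (j : Fin n) => ∑ i, u i * α j i)
    (μ : Submodule F (Fin ℓ → F) → Submodule F (Fin ℓ → F) → ℤ)
    (hμ1 : ∀ X ∈ interLattice F ℓ n α, μ X X = 1)
    (hμ2 : ∀ X ∈ interLattice F ℓ n α, ∀ Y ∈ interLattice F ℓ n α, Y < X →
      ∑ Z ∈ (interLattice F ℓ n α).filter (fun Z => Y ≤ Z ∧ Z ≤ X), μ X Z = 0)
    (hμ0 : ∀ X Y : Submodule F (Fin ℓ → F), ¬ Y ≤ X → μ X Y = 0) :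
    ∑ X ∈ interLattice F ℓ n α,
        Polynomial.C (∑ Y ∈ (interLattice F ℓ n α).filter (fun Y => Y ≤ X),
            μ X Y * (Fintype.card F : ℤ) ^ Module.finrank F Y) *
          Polynomial.X ^ numAtoms F ℓ n α X =
      ∑ c ∈ Finset.image (fun (u : Fin ℓ → F) (j : Fin n) => ∑ i, u i * α j i) Finset.univ,
        (Polynomial.X : Polynomial ℤ) ^ (n - hamWt c) := by
  rw [Finset.sum_image (fun a _ b _ h => hinj h)]
  have hcard : ∀ Y ∈ interLattice F ℓ n α, (Fintype.card F : ℤ) ^ Module.finrank F Y =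
      ∑ u : Fin ℓ → F, if flatOf F ℓ n α u ≤ Y then 1 else 0 := by
    intro Y hY
    have h1 : Fintype.card Y = Fintype.card F ^ Module.finrank F Y :=
      Module.card_eq_pow_finrank
    rw [← Nat.cast_pow, ← h1, Fintype.card_subtype, Finset.card_filter]
    push_cast
    refine Finset.sum_congr rfl fun u _ => ?_
    simp only [flatOf_le_iff F ℓ n α u Y hY]
  have key : ∀ X ∈ interLattice F ℓ n α,
      ∑ Y ∈ (interLattice F ℓ n α).filter (fun Y => Y ≤ X),
            μ X Y * (Fintype.card F : ℤ) ^ Module.finrank F Y =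
      ∑ u : Fin ℓ → F, if flatOf F ℓ n α u = X then 1 else 0 := by
    intro X hX
    rw [Finset.sum_congr rfl (fun Y hY => by rw [hcard Y (Finset.mem_filter.1 hY).1])]
    simp only [Finset.mul_sum]
    rw [Finset.sum_comm]
    refine Finset.sum_congr rfl fun u _ => ?_
    simp only [mul_ite, mul_one, mul_zero]
    rw [← Finset.sum_filter, Finset.filter_filter]
    simp only [and_comm (b := flatOf F ℓ n α u ≤ _)]
    have hu := flatOf_mem F ℓ n α u
    split_ifs with h
    · rw [h, ← hμ1 X hX]
      rw [Finset.sum_eq_single X]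
      · intro b hb hne
        exact absurd (le_antisymm (Finset.mem_filter.1 hb).2.2 (Finset.mem_filter.1 hb).2.1) hne
      · intro hn
        exact absurd (Finset.mem_filter.2 ⟨hX, le_rfl, le_rfl⟩) hn
    · by_cases hle : flatOf F ℓ n α u ≤ X
      · exact hμ2 X hX _ hu (lt_of_le_of_ne hle h)
      · apply Finset.sum_eq_zero
        intro Y hY
        exact absurd ((Finset.mem_filter.1 hY).2.1.trans (Finset.mem_filter.1 hY).2.2) hle
  rw [Finset.sum_congr rfl (fun X hX => by rw [key X hX])]
  simp only [map_sum, Finset.sum_mul]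
  rw [Finset.sum_comm]
  refine Finset.sum_congr rfl fun u _ => ?_
  rw [Finset.sum_eq_single (flatOf F ℓ n α u)]
  · rw [numAtoms_flatOf]
    simp
  · intro X _ hne
    simp [hne.symm]
  · intro hn
    exact absurd (flatOf_mem F ℓ n α u) hn
end
end

section
/- Let O = ℤ[√−5] with prime ideals 𝔭 = ⟨2, 1−√−5⟩ and 𝔮 = ⟨3, 1+√−5⟩, and let α_1 = (2, 1−√−5)ᵀ, α_2 = (1+√−5, 3)ᵀ ∈ O². Let H = {(a,b) ∈ K² : 2a + (1−√−5)b = 0} where K = ℚ(√−5), and π : K² → (K/O)² the canonical projection. Then π(H) = {π(a,b) ∈ (K/O)² : 2a + (1−√−5)b ∈ 𝔭} = {π(a,b) ∈ (K/O)² : (1+√−5)a + 3b ∈ 𝔮}. -/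
noncomputable section

/-- `√−5` viewed inside the fraction field `K` of `ℤ[√−5]`. -/
def sqrt5 (K : Type*) [Field K] [Algebra (Zsqrtd (-5)) K] : K :=
  algebraMap (Zsqrtd (-5)) K Zsqrtd.sqrtd

/-- `H = {(a,b) ∈ K² : 2a + (1−√−5)b = 0}`. -/
def Hplane (K : Type*) [Field K] [Algebra (Zsqrtd (-5)) K] : Submodule K (Fin 2 → K) :=
  LinearMap.ker ((2 : K) • (LinearMap.proj 0 : (Fin 2 → K) →ₗ[K] K) +
    (1 - sqrt5 K) • (LinearMap.proj 1 : (Fin 2 → K) →ₗ[K] K))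

/-- The prime ideal `𝔭 = ⟨2, 1−√−5⟩` of `ℤ[√−5]`. -/
def pIdeal : Ideal (Zsqrtd (-5)) := Ideal.span {2, 1 - Zsqrtd.sqrtd}

/-- The prime ideal `𝔮 = ⟨3, 1+√−5⟩` of `ℤ[√−5]`. -/
def qIdeal : Ideal (Zsqrtd (-5)) := Ideal.span {3, 1 + Zsqrtd.sqrtd}

theorem aux_mem (K : Type*) [Field K] [Algebra (Zsqrtd (-5)) K] (a b : K) :
    piMap (Zsqrtd (-5)) K 2 ![a, b] ∈
        ((Hplane K).restrictScalars (Zsqrtd (-5))).map (piMap (Zsqrtd (-5)) K 2) ↔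
      ∃ x y : Zsqrtd (-5), 2 * a + (1 - sqrt5 K) * b =
        2 * algebraMap (Zsqrtd (-5)) K x + (1 - sqrt5 K) * algebraMap (Zsqrtd (-5)) K y := by
  constructor
  · rintro ⟨v, hv, hvab⟩
    have hv' : 2 * v 0 + (1 - sqrt5 K) * v 1 = 0 := by
      simpa [Hplane] using hv
    have h0 : (OinK (Zsqrtd (-5)) K).mkQ (v 0) = (OinK (Zsqrtd (-5)) K).mkQ a := congrFun hvab 0
    have h1 : (OinK (Zsqrtd (-5)) K).mkQ (v 1) = (OinK (Zsqrtd (-5)) K).mkQ b := congrFun hvab 1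
    obtain ⟨x, hx⟩ := (Submodule.Quotient.eq _).1 h0.symm
    obtain ⟨y, hy⟩ := (Submodule.Quotient.eq _).1 h1.symm
    rw [Algebra.linearMap_apply] at hx hy
    refine ⟨x, y, ?_⟩
    rw [hx, hy]
    linear_combination hv'
  · rintro ⟨x, y, h⟩
    refine ⟨![a - algebraMap (Zsqrtd (-5)) K x, b - algebraMap (Zsqrtd (-5)) K y], ?_, ?_⟩
    · have : 2 * (a - algebraMap (Zsqrtd (-5)) K x)
          + (1 - sqrt5 K) * (b - algebraMap (Zsqrtd (-5)) K y) = 0 := by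
        linear_combination h
      simpa [Hplane] using this
    · funext i
      fin_cases i
      · refine (Submodule.Quotient.eq _).2 ⟨-x, ?_⟩
        simp
      · refine (Submodule.Quotient.eq _).2 ⟨-y, ?_⟩
        simp

/-- For `O = ℤ[√−5]` and `K = ℚ(√−5)`:
`π(H) = {π(a,b) : 2a + (1−√−5)b ∈ 𝔭} = {π(a,b) : (1+√−5)a + 3b ∈ 𝔮}`. -/
theorem stmt16 (K : Type*) [Field K] [Algebra (Zsqrtd (-5)) K]
    [IsFractionRing (Zsqrtd (-5)) K] (a b : K) :
    (piMap (Zsqrtd (-5)) K 2 ![a, b] ∈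
        ((Hplane K).restrictScalars (Zsqrtd (-5))).map (piMap (Zsqrtd (-5)) K 2) ↔
      ∃ p ∈ pIdeal, 2 * a + (1 - sqrt5 K) * b = algebraMap (Zsqrtd (-5)) K p) ∧
    (piMap (Zsqrtd (-5)) K 2 ![a, b] ∈
        ((Hplane K).restrictScalars (Zsqrtd (-5))).map (piMap (Zsqrtd (-5)) K 2) ↔
      ∃ q ∈ qIdeal, (1 + sqrt5 K) * a + 3 * b = algebraMap (Zsqrtd (-5)) K q) := by
  have inj : Function.Injective (algebraMap (Zsqrtd (-5)) K) := IsFractionRing.injective _ _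
  have h2 : (2 : K) ≠ 0 := by
    intro h
    have : (2 : Zsqrtd (-5)) = 0 := inj (by rw [map_ofNat, map_zero]; exact h)
    exact absurd this (by decide)
  have h3 : (3 : K) ≠ 0 := by
    intro h
    have : (3 : Zsqrtd (-5)) = 0 := inj (by rw [map_ofNat, map_zero]; exact h)
    exact absurd this (by decide)
  have hs : sqrt5 K * sqrt5 K = -5 := by
    have : (Zsqrtd.sqrtd : Zsqrtd (-5)) * Zsqrtd.sqrtd = -5 := by decide
    unfold sqrt5
    rw [← map_mul, this, map_neg, map_ofNat]
  rw [aux_mem]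
  refine ⟨⟨?_, ?_⟩, ⟨?_, ?_⟩⟩
  · rintro ⟨x, y, h⟩
    refine ⟨x * 2 + y * (1 - Zsqrtd.sqrtd), Ideal.mem_span_pair.2 ⟨x, y, rfl⟩, ?_⟩
    rw [h]
    simp only [map_add, map_mul, map_sub, map_one, map_ofNat, sqrt5]
    ring
  · rintro ⟨p, hp, h⟩
    obtain ⟨x, y, rfl⟩ := Ideal.mem_span_pair.1 hp
    refine ⟨x, y, ?_⟩
    rw [h]
    simp only [map_add, map_mul, map_sub, map_one, map_ofNat, sqrt5]
    ring
  · rintro ⟨x, y, h⟩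
    refine ⟨y * 3 + x * (1 + Zsqrtd.sqrtd), Ideal.mem_span_pair.2 ⟨y, x, rfl⟩, ?_⟩
    simp only [map_add, map_mul, map_one, map_ofNat]
    change _ = _ + _ * (1 + sqrt5 K)
    apply mul_left_cancel₀ h2
    linear_combination (1 + sqrt5 K) * h + (b - algebraMap (Zsqrtd (-5)) K y) * hs
  · rintro ⟨p, hp, h⟩
    obtain ⟨y, x, rfl⟩ := Ideal.mem_span_pair.1 hp
    refine ⟨x, y, ?_⟩
    simp only [map_add, map_mul, map_one, map_ofNat] at h
    change _ = _ + _ * (1 + sqrt5 K) at h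
    apply mul_left_cancel₀ h3
    linear_combination (1 - sqrt5 K) * h + (a - algebraMap (Zsqrtd (-5)) K x) * hs
end
end
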